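/- arXiv:1608.06595 — 2 statements merged into one kernel-verified Lean document; each statement's English description precedes it below -/
import Mathlib

section
/- There exist a group G and an action of G on ℝ such that: every g ∈ G acts as a C^∞ diffeomorphism of ℝ; for every nonempty G-invariant open subset V of ℝ the restricted G-action on V is effective (for every g ≠ 1 there exists x ∈ V with g•x ≠ x); yet the action is not fixpoint rare — indeed there exists g ∈ G with g ≠ 1 whose fixed-point set is exactly the interval [−1, 1]. (Hence in the preceding theorem the connectedness hypothesis on G cannot be dropped, even when X is connected.) -/
open Set

/-- The group of `C^∞` diffeomorphisms of `ℝ`. -/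
def smoothDiffeoGroup : Subgroup (Equiv.Perm ℝ) where
  carrier := {e | ContDiff ℝ (⊤ : ℕ∞) e ∧ ContDiff ℝ (⊤ : ℕ∞) e.symm}
  one_mem' := ⟨contDiff_id, contDiff_id⟩
  mul_mem' := fun ha hb => ⟨ha.1.comp hb.1, hb.2.comp ha.2⟩
  inv_mem' := fun ha => ⟨ha.2, ha.1⟩

theorem expNegInvGlue_monotone : Monotone expNegInvGlue := by
  intro x y hxy
  rcases le_or_gt x 0 with hx | hx
  · rw [expNegInvGlue.zero_of_nonpos hx]
    exact expNegInvGlue.nonneg y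
  · have hy := hx.trans_le hxy
    simp only [expNegInvGlue, hx.not_ge, hy.not_ge, if_false]
    gcongr

/-- A smooth function on `ℝ` that fixes exactly the points of `[-1, 1]`. -/
noncomputable def stretchOutside (x : ℝ) : ℝ :=
  x + expNegInvGlue (x - 1) - expNegInvGlue (-x - 1)

theorem contDiff_stretchOutside : ContDiff ℝ (⊤ : ℕ∞) stretchOutside :=
  (contDiff_id.add (expNegInvGlue.contDiff.comp (contDiff_id.sub contDiff_const))).sub
    (expNegInvGlue.contDiff.comp (contDiff_id.neg.sub contDiff_const))

theorem monotone_stretchOutside_sub_id : Monotone fun x => stretchOutside x - x := by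
  intro x y hxy
  have h₁ := expNegInvGlue_monotone (sub_le_sub_right hxy 1)
  have h₂ := expNegInvGlue_monotone (sub_le_sub_right (neg_le_neg hxy) 1)
  simp only [stretchOutside]
  linarith

theorem strictMono_stretchOutside : StrictMono stretchOutside := by
  intro x y hxy
  have h := monotone_stretchOutside_sub_id hxy.le
  simp only at h
  linarith

theorem deriv_stretchOutside_ne_zero (x : ℝ) : deriv stretchOutside x ≠ 0 := by
  have hd : DifferentiableAt ℝ stretchOutside x :=
    contDiff_stretchOutside.differentiable (by simp) x
  have h := monotone_stretchOutside_sub_id.deriv_nonneg (x := x)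
  have h' : deriv (fun x => stretchOutside x - x) x = deriv stretchOutside x - 1 :=
    (hd.hasDerivAt.sub (hasDerivAt_id x)).deriv
  rw [h'] at h
  linarith

theorem stretchOutside_eq_self_iff (x : ℝ) : stretchOutside x = x ↔ x ∈ Icc (-1 : ℝ) 1 := by
  constructor
  · intro h
    simp only [stretchOutside] at h
    by_contra hx
    rw [mem_Icc, not_and_or, not_le, not_le] at hx
    rcases hx with hx | hx
    · rw [expNegInvGlue.zero_of_nonpos (by linarith : x - 1 ≤ 0)] at h
      have := expNegInvGlue.pos_of_pos (by linarith : 0 < -x - 1)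
      linarith
    · rw [expNegInvGlue.zero_of_nonpos (by linarith : -x - 1 ≤ 0)] at h
      have := expNegInvGlue.pos_of_pos (by linarith : 0 < x - 1)
      linarith
  · rintro ⟨h₁, h₂⟩
    simp [stretchOutside, expNegInvGlue.zero_of_nonpos (by linarith : x - 1 ≤ 0),
      expNegInvGlue.zero_of_nonpos (by linarith : -x - 1 ≤ 0)]

theorem surjective_stretchOutside : Function.Surjective stretchOutside := by
  have h₀ : stretchOutside 0 = 0 := (stretchOutside_eq_self_iff 0).2 (by simp)
  refine contDiff_stretchOutside.continuous.surjective ?_ ?_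
  · refine Filter.tendsto_atTop_mono' _ ?_ Filter.tendsto_id
    filter_upwards [Filter.eventually_ge_atTop 0] with x hx
    have h := monotone_stretchOutside_sub_id hx
    simp only [h₀] at h
    simp only [id]
    linarith
  · refine Filter.tendsto_atBot_mono' _ ?_ Filter.tendsto_id
    filter_upwards [Filter.eventually_le_atBot 0] with x hx
    have h := monotone_stretchOutside_sub_id hx
    simp only [h₀] at h
    simp only [id]
    linarith

/-- `stretchOutside` as a homeomorphism of `ℝ`. -/
noncomputable def stretchOutsideHomeomorph : ℝ ≃ₜ ℝ :=
  (strictMono_stretchOutside.orderIsoOfSurjective _ surjective_stretchOutside).toHomeomorph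

theorem contDiff_stretchOutsideHomeomorph_symm :
    ContDiff ℝ (⊤ : ℕ∞) stretchOutsideHomeomorph.symm :=
  stretchOutsideHomeomorph.contDiff_symm_deriv deriv_stretchOutside_ne_zero
    (fun x => (contDiff_stretchOutside.differentiable (by simp) x).hasDerivAt)
    contDiff_stretchOutside

theorem addRight_mem_smoothDiffeoGroup (c : ℝ) : Equiv.addRight c ∈ smoothDiffeoGroup :=
  ⟨contDiff_id.add contDiff_const, contDiff_id.add contDiff_const⟩

/-- There is a (disconnected) group acting on `ℝ` by `C^∞`
diffeomorphisms, effectively on every nonempty invariant open set, which is not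
fixpoint rare: some nontrivial element has fixed-point set exactly `[-1, 1]`. -/
theorem exists_effective_not_fixpoint_rare_action_on_real :
    ∃ (G : Type) (_ : Group G) (ρ : G →* Equiv.Perm ℝ),
      (∀ g : G, ContDiff ℝ (⊤ : ℕ∞) (ρ g : ℝ → ℝ)) ∧
      (∀ V : Set ℝ, IsOpen V → V.Nonempty →
        (∀ (g : G), ∀ x ∈ V, ρ g x ∈ V) →
        ∀ g : G, g ≠ 1 → ∃ x ∈ V, ρ g x ≠ x) ∧
      (∃ g : G, g ≠ 1 ∧ {x : ℝ | ρ g x = x} = Set.Icc (-1 : ℝ) 1) := by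
  refine ⟨smoothDiffeoGroup, inferInstance, smoothDiffeoGroup.subtype, fun g => g.2.1, ?_, ?_⟩
  · rintro V - ⟨v, hv⟩ hV g hg
    have hmem (x : ℝ) : x ∈ V := by
      simpa using hV ⟨_, addRight_mem_smoothDiffeoGroup (x - v)⟩ v hv
    by_contra! h
    exact hg (Subtype.ext (Equiv.ext fun x => h x (hmem x)))
  · have hfix : {x : ℝ | stretchOutside x = x} = Icc (-1 : ℝ) 1 :=
      Set.ext stretchOutside_eq_self_iff
    refine ⟨⟨stretchOutsideHomeomorph.toEquiv, contDiff_stretchOutside,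
      contDiff_stretchOutsideHomeomorph_symm⟩, fun h => ?_, hfix⟩
    have h₂ : stretchOutside 2 = 2 := congrArg (fun e : smoothDiffeoGroup => e.1 2) h
    have := ((stretchOutside_eq_self_iff 2).1 h₂).2
    norm_num at this
end

section
/- Let n ≥ 2 be an integer. For s = (s₁,…,sₙ) ∈ ℝ^n define σ_s : ℝ² → ℝ² by σ_s(x,y) := (x, y + s₁x + s₂x² + ⋯ + sₙxⁿ). Then for every point (x₀,y₀) ∈ ℝ² there exists a linear subspace W of ℝ^n with dim W ≥ 1 such that for every s ∈ W the map σ_s − id_{ℝ²} vanishes to order n − 2 at (x₀,y₀), i.e., σ_s agrees with the identity map to order n − 2 at (x₀,y₀). (Consequently, in the paper's main theorem the (n−1)st order frame bundle cannot be replaced by the (n−2)nd order frame bundle.) -/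
open Set

/-- `h` vanishes to order `m` at `p`: all iterated derivatives of order `≤ m`
(including the value itself) vanish at `p`. -/
def VanishesToOrder {E F : Type*} [NormedAddCommGroup E] [NormedSpace ℝ E]
    [NormedAddCommGroup F] [NormedSpace ℝ F] (m : ℕ) (h : E → F) (p : E) : Prop :=
  ∀ i ≤ m, iteratedFDeriv ℝ i h p = 0

open Polynomial in
/-- A polynomial of degree at most `n` without constant term, written through its coefficients
of positive degree. -/
theorem sum_fin_coeff_succ_mul_pow {R : Type*} [CommRing R] {n : ℕ} {P : R[X]}
    (hdeg : P.natDegree ≤ n) (h0 : P.coeff 0 = 0) (x : R) :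
    ∑ i : Fin n, P.coeff (i + 1) * x ^ ((i : ℕ) + 1) = P.eval x := by
  rw [Polynomial.eval_eq_sum_range' (Nat.lt_succ_of_le hdeg), Finset.sum_range_succ', h0,
    zero_mul, add_zero, Finset.sum_range]

section VanishesToOrder

variable {E F : Type*} [NormedAddCommGroup E] [NormedSpace ℝ E]
  [NormedAddCommGroup F] [NormedSpace ℝ F]

/-- Multiplication by a smooth function vanishing at `p` raises the order of vanishing at `p`. -/
theorem VanishesToOrder.smul_succ {m : ℕ} {u : E → ℝ} {h : E → F} {p : E}
    (hh : VanishesToOrder m h p) (hu : ContDiff ℝ (⊤ : ℕ∞) u) (hhs : ContDiff ℝ (⊤ : ℕ∞) h)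
    (hup : u p = 0) :
    VanishesToOrder (m + 1) (fun x => u x • h x) p := by
  intro i hi
  rw [← norm_le_zero_iff]
  refine (norm_iteratedFDeriv_smul_le hu hhs p (n := i) (mod_cast le_top)).trans
    (Finset.sum_nonpos fun j _ => le_of_eq ?_)
  rcases Nat.eq_zero_or_pos j with rfl | hj
  · simp [hup]
  · simp [hh (i - j) (by omega)]

/-- If `u p = 0`, then `u ^ (m + 1) • g` vanishes to order `m` at `p`. -/
theorem vanishesToOrder_pow_succ_smul {u : E → ℝ} {g : E → F} {p : E}
    (hu : ContDiff ℝ (⊤ : ℕ∞) u) (hg : ContDiff ℝ (⊤ : ℕ∞) g) (hup : u p = 0) (m : ℕ) :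
    VanishesToOrder m (fun x => u x ^ (m + 1) • g x) p := by
  induction m with
  | zero =>
    intro i hi
    obtain rfl : i = 0 := by omega
    ext
    simp [hup]
  | succ m ih =>
    have h := ih.smul_succ hu ((hu.pow (m + 1)).smul hg) hup
    simpa only [smul_smul, ← pow_succ'] using h

end VanishesToOrder

/-- For the shear maps `σ_s(x,y) = (x, y + s₁x + ⋯ + sₙxⁿ)` with
`n ≥ 2`: at every point of `ℝ²` there is a subspace `W ⊆ ℝⁿ` of dimension `≥ 1`
all of whose elements `s` have `σ_s` agreeing with the identity to order `n - 2`
at that point. -/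
theorem exists_subspace_shear_agrees_with_id_to_order
    (n : ℕ) (hn : 2 ≤ n)
    (σ : (Fin n → ℝ) → ℝ × ℝ → ℝ × ℝ)
    (hσ : ∀ (s : Fin n → ℝ) (p : ℝ × ℝ),
      σ s p = (p.1, p.2 + ∑ i : Fin n, s i * p.1 ^ ((i : ℕ) + 1)))
    (x₀ y₀ : ℝ) :
    ∃ W : Submodule ℝ (Fin n → ℝ), 1 ≤ Module.finrank ℝ W ∧
      ∀ s ∈ W, VanishesToOrder (n - 2) (fun p : ℝ × ℝ => σ s p - p) ((x₀, y₀) : ℝ × ℝ) := by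
  obtain ⟨m, rfl⟩ : ∃ m, n = m + 2 := ⟨n - 2, by omega⟩
  let P : Polynomial ℝ := Polynomial.X * (Polynomial.X - Polynomial.C x₀) ^ (m + 1)
  have hmonic : P.Monic := Polynomial.monic_X.mul ((Polynomial.monic_X_sub_C x₀).pow _)
  have hdeg : P.natDegree = m + 2 := by
    rw [Polynomial.monic_X.natDegree_mul ((Polynomial.monic_X_sub_C x₀).pow _),
      Polynomial.natDegree_X, Polynomial.natDegree_pow, Polynomial.natDegree_X_sub_C]
    ring
  let v : Fin (m + 2) → ℝ := fun i => P.coeff (i + 1)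
  have hv : v ≠ 0 := by
    intro h
    have h1 : P.coeff (m + 2) = 0 := congrFun h (Fin.last (m + 1))
    rw [← hdeg, hmonic.coeff_natDegree] at h1
    exact one_ne_zero h1
  refine ⟨Submodule.span ℝ {v}, (finrank_span_singleton hv).ge, fun s hs => ?_⟩
  obtain ⟨c, rfl⟩ := Submodule.mem_span_singleton.1 hs
  have hfun : (fun p : ℝ × ℝ => σ (c • v) p - p) =
      fun p => (p.1 - x₀) ^ (m + 1) • ((0 : ℝ), c * p.1) := by
    funext p
    have hsum := sum_fin_coeff_succ_mul_pow hdeg.le (by simp [P]) p.1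
    rw [hσ]
    ext
    · simp
    · simp only [Pi.smul_apply, smul_eq_mul, mul_assoc, ← Finset.mul_sum, Prod.snd_sub,
        Prod.smul_snd, v, hsum]
      simp [P]
      ring
  rw [hfun]
  exact vanishesToOrder_pow_succ_smul (u := fun p : ℝ × ℝ => p.1 - x₀)
    (g := fun p => ((0 : ℝ), c * p.1)) (by fun_prop)
    (by fun_prop) (sub_self x₀) m
end
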